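/- For all integers n ≥ k ≥ 1 one has the identity (in ℚ): Σ_{π ∈ Π_n^k} crol(π) = (n(k−1)/2 − (5/4)·k(k−1))·S_{n,k} + (3/2)·(n+1−k)·S_{n,k−1}. Equivalently, the average number of linear crossings in a random set partition of [n] into k blocks equals n(k−1)/2 − (5/2)·C(k,2) + (3/2)·(n+1−k)·S_{n,k−1}/S_{n,k}. -/

import Mathlib

open scoped Classical

def seg (n : ℕ) : Finset ℕ := Finset.Icc 1 n

def IsPartition (P : Finset (Finset ℕ)) (S : Finset ℕ) : Prop :=
  ∅ ∉ P ∧ (∀ B ∈ P, ∀ C ∈ P, B ≠ C → Disjoint B C) ∧ P.biUnion id = S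

noncomputable def partitions (n : ℕ) : Finset (Finset (Finset ℕ)) :=
  ((seg n).powerset.powerset).filter fun P => IsPartition P (seg n)

noncomputable def partitionsK (n k : ℕ) : Finset (Finset (Finset ℕ)) :=
  (partitions n).filter fun P => P.card = k

noncomputable def bell (n : ℕ) : ℕ := (partitions n).card

noncomputable def stirling (n k : ℕ) : ℕ := (partitionsK n k).card

/-- `(i, j)` is an edge of the set partition `P`. -/
def IsEdge (P : Finset (Finset ℕ)) (i j : ℕ) : Prop :=
  i < j ∧ ∃ B ∈ P, i ∈ B ∧ j ∈ B ∧ ∀ p ∈ B, ¬(i < p ∧ p < j)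

/-- `crol P`: number of linear crossings. -/
noncomputable def crol (P : Finset (Finset ℕ)) : ℕ :=
  Nat.card {e : (ℕ × ℕ) × ℕ × ℕ //
    IsEdge P e.1.1 e.1.2 ∧ IsEdge P e.2.1 e.2.2 ∧
      e.1.1 < e.2.1 ∧ e.2.1 < e.1.2 ∧ e.1.2 < e.2.2}

/-- `(i, j)` is a circular edge of `P`. -/
def IsCircEdge (P : Finset (Finset ℕ)) (i j : ℕ) : Prop :=
  IsEdge P i j ∨
    ∃ B ∈ P, ∃ h : B.Nonempty, 2 ≤ B.card ∧ i = B.min' h ∧ j = B.max' h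

/-- `croc P`: number of circular crossings. -/
noncomputable def croc (P : Finset (Finset ℕ)) : ℕ :=
  Nat.card {e : (ℕ × ℕ) × ℕ × ℕ //
    IsCircEdge P e.1.1 e.1.2 ∧ IsCircEdge P e.2.1 e.2.2 ∧
      e.1.1 < e.2.1 ∧ e.2.1 < e.1.2 ∧ e.1.2 < e.2.2}

/-- Two blocks overlap: `min B < min B' < max B < max B'`. -/
def Overlap (B B' : Finset ℕ) : Prop :=
  ∃ (h : B.Nonempty) (h' : B'.Nonempty),
    B.min' h < B'.min' h' ∧ B'.min' h' < B.max' h ∧ B.max' h < B'.max' h'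

/-- `ov P`: number of (unordered) pairs of blocks of `P` that overlap. -/
noncomputable def ov (P : Finset (Finset ℕ)) : ℕ :=
  Nat.card {p : Finset ℕ × Finset ℕ // p.1 ∈ P ∧ p.2 ∈ P ∧ Overlap p.1 p.2}

/-- Two blocks embrace: `min B < min B' ≤ max B' < max B`. -/
def Embrace (B B' : Finset ℕ) : Prop :=
  ∃ (h : B.Nonempty) (h' : B'.Nonempty),
    B.min' h < B'.min' h' ∧ B'.min' h' ≤ B'.max' h' ∧ B'.max' h' < B.max' h

noncomputable def emb (P : Finset (Finset ℕ)) : ℕ :=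
  Nat.card {p : Finset ℕ × Finset ℕ // p.1 ∈ P ∧ p.2 ∈ P ∧ Embrace p.1 p.2}

/-- The block of `P` containing `i`. -/
noncomputable def blockOf (P : Finset (Finset ℕ)) (i : ℕ) : Finset ℕ :=
  (P.filter fun B => i ∈ B).biUnion id

/-- The restricted growth function of `P`: `rgf P i = j` iff `i` lies in the `j`-th
block of `P`, the blocks being ordered by increasing minima. -/
noncomputable def rgf (P : Finset (Finset ℕ)) (i : ℕ) : ℕ :=
  (P.filter fun B => B.min ≤ (blockOf P i).min).card

/-- A 2-pattern: a word on `{1,2}` containing both letters. -/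
def TwoPattern {r : ℕ} (σ : Fin r → ℕ) : Prop :=
  (∀ t, σ t = 1 ∨ σ t = 2) ∧ (∃ t, σ t = 1) ∧ (∃ t, σ t = 2)

/-- `occ n σ P`: number of occurrences of the 2-pattern `σ` in the partition `P` of `[n]`. -/
noncomputable def occ (n : ℕ) {r : ℕ} (σ : Fin r → ℕ) (P : Finset (Finset ℕ)) : ℕ :=
  Nat.card {i : Fin r → ℕ // StrictMono i ∧ (∀ t, i t ∈ seg n) ∧
    ∃ a b : ℕ, a < b ∧
      ∀ t, (σ t = 1 → rgf P (i t) = a) ∧ (σ t = 2 → rgf P (i t) = b)}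

/-- Carlitz `q`-Stirling polynomials. -/
noncomputable def qS : ℕ → ℕ → Polynomial ℚ
  | 0, 0 => 1
  | 0, _ + 1 => 0
  | _ + 1, 0 => 0
  | n + 1, k + 1 =>
      Polynomial.X ^ k * qS n k +
        (∑ i ∈ Finset.range (k + 1), Polynomial.X ^ i) * qS n (k + 1)

/-- Standardization: the order preserving bijection `S → [|S|]`. -/
def stdMap (S : Finset ℕ) (a : ℕ) : ℕ := (S.filter fun x => x ≤ a).card

/-- The standardized 2-block partition obtained from two blocks `A, B`. -/
def stdPair (A B : Finset ℕ) : Finset (Finset ℕ) :=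
  {A.image (stdMap (A ∪ B)), B.image (stdMap (A ∪ B))}

lemma isPartition_iff {P : Finset (Finset ℕ)} {S : Finset ℕ} :
    IsPartition P S ↔ ∅ ∉ P ∧ (∀ B ∈ P, ∀ C ∈ P, ∀ x ∈ B, x ∈ C → B = C) ∧
      ∀ x, x ∈ S ↔ ∃ B ∈ P, x ∈ B := by
  unfold IsPartition
  refine and_congr_right fun _ => and_congr ?_ ?_
  · refine forall₄_congr fun B _ C _ => ?_
    rw [not_imp_comm, Finset.not_disjoint_iff]
    exact ⟨fun h x hB hC => h ⟨x, hB, hC⟩, fun h ⟨x, hB, hC⟩ => h x hB hC⟩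
  · simp only [Finset.ext_iff, Finset.mem_biUnion, id]
    exact forall_congr' fun x => Iff.comm

lemma mem_partitions {n : ℕ} {P : Finset (Finset ℕ)} :
    P ∈ partitions n ↔ IsPartition P (seg n) := by
  simp only [partitions, Finset.mem_filter, Finset.mem_powerset, and_iff_right_iff_imp]
  intro h B hB
  rw [Finset.mem_powerset]
  intro x hx
  exact ((isPartition_iff.1 h).2.2 x).2 ⟨B, hB, hx⟩

/-- Add the element `m` to the block `B` of `P`; for `B = ∅`, add the singleton block `{m}`. -/
def addTo (m : ℕ) (P : Finset (Finset ℕ)) (B : Finset ℕ) : Finset (Finset ℕ) :=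
  insert (insert m B) (P.erase B)

lemma lt_of_mem_block {n : ℕ} {P : Finset (Finset ℕ)} (h : IsPartition P (seg n))
    {B : Finset ℕ} (hB : B ∈ P) {x : ℕ} (hx : x ∈ B) : x < n + 1 := by
  have := ((isPartition_iff.1 h).2.2 x).2 ⟨B, hB, hx⟩
  simp only [seg, Finset.mem_Icc] at this
  omega

lemma nonempty_of_mem {S : Finset ℕ} {P : Finset (Finset ℕ)} (h : IsPartition P S)
    {B : Finset ℕ} (hB : B ∈ P) : B.Nonempty :=
  Finset.nonempty_iff_ne_empty.2 fun h0 => h.1 (h0 ▸ hB)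

lemma mem_seg_succ {n x : ℕ} : x ∈ seg (n + 1) ↔ x = n + 1 ∨ x ∈ seg n := by
  simp only [seg, Finset.mem_Icc]
  omega

lemma notMem_of_mem_insert_empty {n : ℕ} {P : Finset (Finset ℕ)} (h : IsPartition P (seg n))
    {B : Finset ℕ} (hB : B ∈ insert ∅ P) : n + 1 ∉ B := by
  intro hx
  rcases Finset.mem_insert.1 hB with rfl | hB
  · simp at hx
  · exact (lt_of_mem_block h hB hx).ne rfl

lemma isPartition_addTo {n : ℕ} {P : Finset (Finset ℕ)} (h : IsPartition P (seg n))
    {B : Finset ℕ} (hB : B ∈ insert ∅ P) : IsPartition (addTo (n + 1) P B) (seg (n + 1)) := by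
  obtain ⟨h0, hd, hc⟩ := isPartition_iff.1 h
  have key : ∀ C ∈ P.erase B, ∀ x ∈ C, x ∉ insert (n + 1) B := by
    intro C hC x hxC hx
    obtain ⟨hne, hCP⟩ := Finset.mem_erase.1 hC
    rcases Finset.mem_insert.1 hx with rfl | hxB
    · exact (lt_of_mem_block h hCP hxC).ne rfl
    · rcases Finset.mem_insert.1 hB with rfl | hB
      · simp at hxB
      · exact hne (hd C hCP B hB x hxC hxB)
  refine isPartition_iff.2 ⟨?_, ?_, ?_⟩
  · simp only [addTo, Finset.mem_insert, Finset.mem_erase, not_or]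
    exact ⟨(Finset.insert_ne_empty _ _).symm, fun h => h0 h.2⟩
  · intro C hC D hD x hxC hxD
    rcases Finset.mem_insert.1 hC with rfl | hC <;> rcases Finset.mem_insert.1 hD with rfl | hD
    · rfl
    · exact absurd hxC (key D hD x hxD)
    · exact absurd hxD (key C hC x hxC)
    · exact hd C (Finset.mem_of_mem_erase hC) D (Finset.mem_of_mem_erase hD) x hxC hxD
  · intro x
    rw [mem_seg_succ, hc]
    constructor
    · rintro (rfl | ⟨C, hC, hx⟩)
      · exact ⟨_, Finset.mem_insert_self _ _, Finset.mem_insert_self _ _⟩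
      · by_cases hCB : C = B
        · subst hCB
          exact ⟨_, Finset.mem_insert_self _ _, Finset.mem_insert_of_mem hx⟩
        · exact ⟨C, Finset.mem_insert_of_mem (Finset.mem_erase.2 ⟨hCB, hC⟩), hx⟩
    · rintro ⟨C, hC, hx⟩
      rcases Finset.mem_insert.1 hC with rfl | hC
      · rcases Finset.mem_insert.1 hx with rfl | hx
        · exact Or.inl rfl
        · rcases Finset.mem_insert.1 hB with rfl | hB
          · simp at hx
          · exact Or.inr ⟨B, hB, hx⟩
      · exact Or.inr ⟨C, Finset.mem_of_mem_erase hC, hx⟩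

lemma mem_of_mem_addTo {n : ℕ} {P : Finset (Finset ℕ)} {B C : Finset ℕ}
    (hC : C ∈ addTo (n + 1) P B) (hn : n + 1 ∉ C) : C ∈ P.erase B := by
  rcases Finset.mem_insert.1 hC with rfl | hC
  · simp at hn
  · exact hC

lemma eq_of_addTo_eq {n : ℕ} {P Q : Finset (Finset ℕ)} (hP : IsPartition P (seg n))
    (hQ : IsPartition Q (seg n)) {B C : Finset ℕ} (hB : B ∈ insert ∅ P) (hC : C ∈ insert ∅ Q)
    (h : addTo (n + 1) P B = addTo (n + 1) Q C) : P = Q ∧ B = C := by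
  have hBC : B = C := by
    have h1 : insert (n + 1) B ∈ addTo (n + 1) Q C := h ▸ Finset.mem_insert_self _ _
    rcases Finset.mem_insert.1 h1 with h1 | h1
    · rw [← Finset.erase_insert (notMem_of_mem_insert_empty hP hB), h1,
        Finset.erase_insert (notMem_of_mem_insert_empty hQ hC)]
    · exact absurd rfl (lt_of_mem_block hQ (Finset.mem_of_mem_erase h1)
        (Finset.mem_insert_self _ _)).ne
  subst hBC
  have hPQ : P.erase B = Q.erase B := by
    ext X
    constructor <;> intro hX
    · exact mem_of_mem_addTo (h ▸ Finset.mem_insert_of_mem hX)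
        (fun hn => (lt_of_mem_block hP (Finset.mem_of_mem_erase hX) hn).ne rfl)
    · exact mem_of_mem_addTo (h.symm ▸ Finset.mem_insert_of_mem hX)
        (fun hn => (lt_of_mem_block hQ (Finset.mem_of_mem_erase hX) hn).ne rfl)
  refine ⟨?_, rfl⟩
  by_cases hBe : B = ∅
  · subst hBe
    rwa [Finset.erase_eq_of_notMem hP.1, Finset.erase_eq_of_notMem hQ.1] at hPQ
  · rw [← Finset.insert_erase ((Finset.mem_insert.1 hB).resolve_left hBe), hPQ,
      Finset.insert_erase ((Finset.mem_insert.1 hC).resolve_left hBe)]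

lemma exists_addTo_eq {n : ℕ} {P : Finset (Finset ℕ)} (h : IsPartition P (seg (n + 1))) :
    ∃ Q, IsPartition Q (seg n) ∧ ∃ B ∈ insert ∅ Q, addTo (n + 1) Q B = P := by
  obtain ⟨h0, hd, hc⟩ := isPartition_iff.1 h
  obtain ⟨D, hD, hnD⟩ := (hc (n + 1)).1 (mem_seg_succ.2 (Or.inl rfl))
  have hneB : ∀ X ∈ P, X ≠ D.erase (n + 1) := by
    rintro X hX rfl
    obtain ⟨x, hx⟩ := nonempty_of_mem h hX
    have := hd _ hX D hD x hx (Finset.mem_of_mem_erase hx)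
    exact Finset.notMem_erase (n + 1) D (this.symm ▸ hnD)
  have hmem : ∀ X, X ∈ (insert (D.erase (n + 1)) (P.erase D)).erase ∅ ↔
      X ≠ ∅ ∧ (X = D.erase (n + 1) ∨ X ≠ D ∧ X ∈ P) := by simp
  refine ⟨(insert (D.erase (n + 1)) (P.erase D)).erase ∅, isPartition_iff.2 ⟨by simp, ?_, ?_⟩,
    D.erase (n + 1), ?_, ?_⟩
  · intro X hX Y hY x hxX hxY
    rcases ((hmem X).1 hX).2 with rfl | ⟨hXD, hX⟩ <;> rcases ((hmem Y).1 hY).2 with rfl | ⟨hYD, hY⟩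
    · rfl
    · exact absurd (hd Y hY D hD x hxY (Finset.mem_of_mem_erase hxX)) hYD
    · exact absurd (hd X hX D hD x hxX (Finset.mem_of_mem_erase hxY)) hXD
    · exact hd X hX Y hY x hxX hxY
  · intro x
    constructor
    · intro hx
      have hxn : x ≠ n + 1 := by
        simp only [seg, Finset.mem_Icc] at hx
        omega
      obtain ⟨X, hX, hxX⟩ := (hc x).1 (mem_seg_succ.2 (Or.inr hx))
      by_cases hXD : X = D
      · subst hXD
        have hx' := Finset.mem_erase.2 ⟨hxn, hxX⟩
        exact ⟨_, (hmem _).2 ⟨Finset.ne_empty_of_mem hx', Or.inl rfl⟩, hx'⟩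
      · exact ⟨X, (hmem X).2 ⟨Finset.ne_empty_of_mem hxX, Or.inr ⟨hXD, hX⟩⟩, hxX⟩
    · rintro ⟨X, hX, hxX⟩
      rcases ((hmem X).1 hX).2 with rfl | ⟨hXD, hX⟩
      · obtain ⟨hxn, hxD⟩ := Finset.mem_erase.1 hxX
        exact (mem_seg_succ.1 ((hc x).2 ⟨D, hD, hxD⟩)).resolve_left hxn
      · refine (mem_seg_succ.1 ((hc x).2 ⟨X, hX, hxX⟩)).resolve_left ?_
        rintro rfl
        exact hXD (hd X hX D hD _ hxX hnD)
  · rw [Finset.mem_insert, hmem]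
    tauto
  · ext X
    rw [addTo, Finset.insert_erase hnD, Finset.mem_insert, Finset.mem_erase, hmem]
    constructor
    · rintro (rfl | ⟨hX, -, hX' | hX'⟩)
      · exact hD
      · exact absurd hX' hX
      · exact hX'.2
    · intro hX
      by_cases hXD : X = D
      · exact Or.inl hXD
      · exact Or.inr ⟨hneB X hX, fun hX0 => h0 (hX0 ▸ hX), Or.inr ⟨hXD, hX⟩⟩

lemma sum_partitions_succ (n : ℕ) (f : Finset (Finset ℕ) → ℚ) :
    ∑ P ∈ partitions (n + 1), f P =
      ∑ P ∈ partitions n, ∑ B ∈ insert ∅ P, f (addTo (n + 1) P B) := by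
  rw [Finset.sum_sigma']
  symm
  refine Finset.sum_bij (fun x _ => addTo (n + 1) x.1 x.2) ?_ ?_ ?_ (fun _ _ => rfl)
  · rintro ⟨P, B⟩ hx
    obtain ⟨hP, hB⟩ := Finset.mem_sigma.1 hx
    exact mem_partitions.2 (isPartition_addTo (mem_partitions.1 hP) hB)
  · rintro ⟨P, B⟩ hx ⟨Q, C⟩ hy h
    obtain ⟨hP, hB⟩ := Finset.mem_sigma.1 hx
    obtain ⟨hQ, hC⟩ := Finset.mem_sigma.1 hy
    obtain ⟨h1, h2⟩ := eq_of_addTo_eq (mem_partitions.1 hP) (mem_partitions.1 hQ) hB hC h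
    simp only at h1 h2
    subst h1 h2
    rfl
  · intro P hP
    obtain ⟨Q, hQ, B, hB, h⟩ := exists_addTo_eq (mem_partitions.1 hP)
    exact ⟨⟨Q, B⟩, Finset.mem_sigma.2 ⟨mem_partitions.2 hQ, hB⟩, h⟩

lemma addTo_empty {S : Finset ℕ} {P : Finset (Finset ℕ)} (h : IsPartition P S) (m : ℕ) :
    addTo m P ∅ = insert {m} P := by
  rw [addTo, Finset.erase_eq_of_notMem h.1]
  rfl

lemma card_addTo_empty {n : ℕ} {P : Finset (Finset ℕ)} (h : IsPartition P (seg n)) :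
    (addTo (n + 1) P ∅).card = P.card + 1 := by
  rw [addTo_empty h, Finset.card_insert_of_notMem]
  exact fun hm => (lt_of_mem_block h hm (Finset.mem_singleton_self _)).ne rfl

lemma card_addTo {n : ℕ} {P : Finset (Finset ℕ)} (h : IsPartition P (seg n)) {B : Finset ℕ}
    (hB : B ∈ P) : (addTo (n + 1) P B).card = P.card := by
  rw [addTo, Finset.card_insert_of_notMem, Finset.card_erase_add_one hB]
  exact fun hm => (lt_of_mem_block h (Finset.mem_of_mem_erase hm) (Finset.mem_insert_self _ _)).ne rfl

lemma sum_partitionsK_succ (n k : ℕ) (f : Finset (Finset ℕ) → ℚ) :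
    ∑ P ∈ partitionsK (n + 1) (k + 1), f P =
      ∑ P ∈ partitionsK n k, f (addTo (n + 1) P ∅) +
        ∑ P ∈ partitionsK n (k + 1), ∑ B ∈ P, f (addTo (n + 1) P B) := by
  simp only [partitionsK, Finset.sum_filter]
  rw [sum_partitions_succ, ← Finset.sum_add_distrib]
  refine Finset.sum_congr rfl fun P hP => ?_
  have hP := mem_partitions.1 hP
  rw [Finset.sum_insert hP.1, card_addTo_empty hP]
  congr 1
  · simp
  · split_ifs with hk
    · exact Finset.sum_congr rfl fun B hB => if_pos ((card_addTo hP hB).trans hk)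
    · exact Finset.sum_eq_zero fun B hB => if_neg (by rwa [card_addTo hP hB])

/-- Every element of `B` is smaller than every element of `C`. -/
def Precedes (B C : Finset ℕ) : Prop := ∀ b ∈ B, ∀ c ∈ C, b < c

/-- `min C < max B < max C`, for disjoint nonempty blocks. -/
def Straddles (B C : Finset ℕ) : Prop :=
  (∃ c ∈ C, ∀ b ∈ B, b < c) ∧ ∃ c ∈ C, ∃ b ∈ B, c < b

/-- The number of ordered pairs of blocks the first of which precedes the second. -/
noncomputable def precCount (P : Finset (Finset ℕ)) : ℚ :=
  ∑ B ∈ P, ∑ C ∈ P, if Precedes B C then 1 else 0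

lemma not_precedes_self {B : Finset ℕ} (h : B.Nonempty) : ¬ Precedes B B := by
  obtain ⟨x, hx⟩ := h
  exact fun h => (h x hx x hx).ne rfl

lemma precCount_addTo_empty {n : ℕ} {P : Finset (Finset ℕ)} (h : IsPartition P (seg n)) :
    precCount (addTo (n + 1) P ∅) = precCount P + P.card := by
  have hm : {n + 1} ∉ P :=
    fun hm => (lt_of_mem_block h hm (Finset.mem_singleton_self _)).ne rfl
  have h1 : ∀ C ∈ P, ¬ Precedes {n + 1} C := by
    intro C hC hp
    obtain ⟨x, hx⟩ := nonempty_of_mem h hC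
    have := hp _ (Finset.mem_singleton_self _) x hx
    have := lt_of_mem_block h hC hx
    omega
  have h2 : ∀ C ∈ P, Precedes C {n + 1} := by
    intro C hC x hx y hy
    rw [Finset.mem_singleton.1 hy]
    exact lt_of_mem_block h hC hx
  rw [addTo_empty h, precCount, Finset.sum_insert hm, Finset.sum_insert hm,
    if_neg (not_precedes_self (Finset.singleton_nonempty _)),
    Finset.sum_eq_zero fun C hC => if_neg (h1 C hC),
    Finset.sum_congr rfl fun C hC => by rw [Finset.sum_insert hm, if_pos (h2 C hC)],
    Finset.sum_add_distrib, precCount]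
  simp
  ring

lemma precCount_addTo {n : ℕ} {P : Finset (Finset ℕ)} (h : IsPartition P (seg n))
    {B : Finset ℕ} (hB : B ∈ P) :
    precCount (addTo (n + 1) P B) =
      precCount P - ∑ C ∈ P, if Precedes B C then 1 else 0 := by
  have hm : insert (n + 1) B ∉ P.erase B :=
    fun hm => (lt_of_mem_block h (Finset.mem_of_mem_erase hm) (Finset.mem_insert_self _ _)).ne rfl
  have h1 : ∀ C ∈ P.erase B, ¬ Precedes (insert (n + 1) B) C := by
    intro C hC hp
    have hC := Finset.mem_of_mem_erase hC
    obtain ⟨x, hx⟩ := nonempty_of_mem h hC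
    have := hp _ (Finset.mem_insert_self _ _) x hx
    have := lt_of_mem_block h hC hx
    omega
  have h2 : ∀ C ∈ P.erase B, (Precedes C (insert (n + 1) B) ↔ Precedes C B) := by
    intro C hC
    have hC := Finset.mem_of_mem_erase hC
    refine ⟨fun hp x hx y hy => hp x hx y (Finset.mem_insert_of_mem hy), fun hp x hx y hy => ?_⟩
    rcases Finset.mem_insert.1 hy with rfl | hy
    · exact lt_of_mem_block h hC hx
    · exact hp x hx y hy
  have h3 : precCount P = ∑ C ∈ P, (if Precedes B C then 1 else 0) +
      ∑ C ∈ P.erase B, ∑ D ∈ P, if Precedes C D then 1 else 0 :=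
    (Finset.add_sum_erase P _ hB).symm
  rw [h3, add_sub_cancel_left, precCount, addTo, Finset.sum_insert hm, Finset.sum_insert hm,
    if_neg (not_precedes_self (Finset.insert_nonempty _ _)),
    Finset.sum_eq_zero fun C hC => if_neg (h1 C hC), zero_add, zero_add]
  refine Finset.sum_congr rfl fun C hC => ?_
  rw [Finset.sum_insert hm, ← Finset.add_sum_erase P _ hB]
  simp only [h2 C hC]

lemma straddles_add_precedes {S : Finset ℕ} {P : Finset (Finset ℕ)} (h : IsPartition P S)
    {B C : Finset ℕ} (hB : B ∈ P) (hC : C ∈ P) :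
    ((if Straddles B C then 1 else 0) + (if Straddles C B then 1 else 0) +
      (if Precedes B C then 1 else 0) + (if Precedes C B then 1 else 0) : ℚ) =
      1 - if B = C then 1 else 0 := by
  have hBn := nonempty_of_mem h hB
  have hCn := nonempty_of_mem h hC
  by_cases hBC : B = C
  · subst hBC
    have : ¬ Straddles B B := fun ⟨⟨x, hx, hx'⟩, _⟩ => (hx' x hx).ne rfl
    simp [this, not_precedes_self hBn]
  have key : ∀ {B C : Finset ℕ}, B.Nonempty → C.Nonempty → (∀ x ∈ B, x ∉ C) →
      (∃ c ∈ C, ∀ b ∈ B, b < c) → ((if Straddles B C then 1 else 0) +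
      (if Straddles C B then 1 else 0) +
      (if Precedes B C then 1 else 0) + (if Precedes C B then 1 else 0) : ℚ) = 1 := by
    intro B C hB hC hd hBC
    obtain ⟨c, hc, hcB⟩ := hBC
    have h1 : ¬ Straddles C B := fun ⟨⟨x, hx, hx'⟩, _⟩ => (hx' c hc).not_gt (hcB x hx)
    have h2 : ¬ Precedes C B := by
      obtain ⟨b, hb⟩ := hB
      exact fun hp => (hp c hc b hb).not_gt (hcB b hb)
    have h3 : Straddles B C ↔ ¬ Precedes B C := by
      simp only [Straddles, Precedes, not_forall, not_lt]
      constructor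
      · rintro ⟨-, x, hx, y, hy, hxy⟩
        exact ⟨y, hy, x, hx, hxy.le⟩
      · rintro ⟨y, hy, x, hx, hxy⟩
        exact ⟨⟨c, hc, hcB⟩, x, hx, y, hy, lt_of_le_of_ne hxy fun hxy => hd y hy (hxy ▸ hx)⟩
    by_cases hp : Precedes B C <;> simp [h1, h2, h3, hp]
  have hd : ∀ x ∈ B, x ∉ C := fun x hx hx' =>
    hBC ((isPartition_iff.1 h).2.1 B hB C hC x hx hx')
  rw [if_neg hBC, sub_zero]
  rcases lt_or_gt_of_ne (fun he => hd _ (B.max'_mem hBn) (he ▸ C.max'_mem hCn) :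
    B.max' hBn ≠ C.max' hCn) with hlt | hlt
  · exact key hBn hCn hd ⟨_, C.max'_mem hCn, fun b hb => (B.le_max' b hb).trans_lt hlt⟩
  · have := key hCn hBn (fun x hx hx' => hd x hx' hx)
      ⟨_, B.max'_mem hBn, fun b hb => (C.le_max' b hb).trans_lt hlt⟩
    linarith

lemma sum_straddles {S : Finset ℕ} {P : Finset (Finset ℕ)} (h : IsPartition P S) :
    (∑ B ∈ P, ∑ C ∈ P, if Straddles B C then (1 : ℚ) else 0) =
      P.card * (P.card - 1) / 2 - precCount P := by
  have key := Finset.sum_congr rfl fun B hB => Finset.sum_congr rfl fun C hC =>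
    straddles_add_precedes h (B := B) (C := C) hB hC
  simp only [Finset.sum_add_distrib, Finset.sum_sub_distrib] at key
  rw [Finset.sum_comm (f := fun B C => if Straddles C B then (1 : ℚ) else 0),
    Finset.sum_comm (f := fun B C => if Precedes C B then (1 : ℚ) else 0),
    Finset.sum_congr rfl fun B hB => show (∑ C ∈ P, if B = C then (1 : ℚ) else 0) = 1 by
      rw [Finset.sum_ite_eq, if_pos hB]] at key
  simp only [Finset.sum_const, nsmul_eq_mul, mul_one] at key
  rw [precCount]
  linarith

lemma isEdge_addTo {n : ℕ} {P : Finset (Finset ℕ)} (h : IsPartition P (seg n))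
    {B : Finset ℕ} (hB : B ∈ insert ∅ P) (i j : ℕ) :
    IsEdge (addTo (n + 1) P B) i j ↔
      IsEdge P i j ∨ j = n + 1 ∧ i ∈ B ∧ ∀ b ∈ B, b ≤ i := by
  have hnB := notMem_of_mem_insert_empty h hB
  have hBP : ∀ x ∈ B, B ∈ P := fun x hx =>
    (Finset.mem_insert.1 hB).resolve_left (Finset.ne_empty_of_mem hx)
  have hlt : ∀ x ∈ B, x < n + 1 := fun x hx => lt_of_mem_block h (hBP x hx) hx
  constructor
  · rintro ⟨hij, C, hC, hi, hj, hC'⟩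
    rcases Finset.mem_insert.1 hC with rfl | hC
    · rcases Finset.mem_insert.1 hi with rfl | hi
      · rcases Finset.mem_insert.1 hj with rfl | hj
        · omega
        · have := hlt j hj
          omega
      · rcases Finset.mem_insert.1 hj with rfl | hj
        · refine Or.inr ⟨rfl, hi, fun b hb => ?_⟩
          have := hC' b (Finset.mem_insert_of_mem hb)
          have := hlt b hb
          omega
        · exact Or.inl ⟨hij, B, hBP i hi, hi, hj, fun p hp =>
            hC' p (Finset.mem_insert_of_mem hp)⟩
    · exact Or.inl ⟨hij, C, Finset.mem_of_mem_erase hC, hi, hj, hC'⟩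
  · rintro (⟨hij, C, hC, hi, hj, hC'⟩ | ⟨rfl, hi, hmax⟩)
    · by_cases hCB : C = B
      · subst hCB
        refine ⟨hij, _, Finset.mem_insert_self _ _, Finset.mem_insert_of_mem hi,
          Finset.mem_insert_of_mem hj, fun p hp => ?_⟩
        rcases Finset.mem_insert.1 hp with rfl | hp
        · have := hlt j hj
          omega
        · exact hC' p hp
      · exact ⟨hij, C, Finset.mem_insert_of_mem (Finset.mem_erase.2 ⟨hCB, hC⟩), hi, hj, hC'⟩
    · refine ⟨hlt i hi, _, Finset.mem_insert_self _ _, Finset.mem_insert_of_mem hi,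
        Finset.mem_insert_self _ _, fun p hp => ?_⟩
      rcases Finset.mem_insert.1 hp with rfl | hp
      · omega
      · have := hmax p hp
        omega

/-- The set of linear crossings of `P`. -/
def crossings (P : Finset (Finset ℕ)) : Set ((ℕ × ℕ) × ℕ × ℕ) :=
  {e | IsEdge P e.1.1 e.1.2 ∧ IsEdge P e.2.1 e.2.2 ∧
      e.1.1 < e.2.1 ∧ e.2.1 < e.1.2 ∧ e.1.2 < e.2.2}

lemma crol_eq_ncard (P : Finset (Finset ℕ)) : crol P = (crossings P).ncard := rfl

/-- The edges of `P` passing over `b`. -/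
def edgesOver (P : Finset (Finset ℕ)) (b : ℕ) : Set (ℕ × ℕ) :=
  {e | IsEdge P e.1 e.2 ∧ e.1 < b ∧ b < e.2}

lemma IsEdge.lt_succ {n : ℕ} {P : Finset (Finset ℕ)} (h : IsPartition P (seg n)) {i j : ℕ}
    (he : IsEdge P i j) : i < n + 1 ∧ j < n + 1 := by
  obtain ⟨-, C, hC, hi, hj, -⟩ := he
  exact ⟨lt_of_mem_block h hC hi, lt_of_mem_block h hC hj⟩

lemma crossings_finite {n : ℕ} {P : Finset (Finset ℕ)} (h : IsPartition P (seg n)) :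
    (crossings P).Finite := by
  have hI := Set.finite_Iio (n + 1)
  refine ((hI.prod hI).prod (hI.prod hI)).subset ?_
  rintro ⟨⟨i, j⟩, i', j'⟩ ⟨h1, h2, -⟩
  exact ⟨h1.lt_succ h, h2.lt_succ h⟩

lemma edgesOver_finite {n : ℕ} {P : Finset (Finset ℕ)} (h : IsPartition P (seg n)) (b : ℕ) :
    (edgesOver P b).Finite := by
  have hI := Set.finite_Iio (n + 1)
  refine (hI.prod hI).subset ?_
  rintro ⟨i, j⟩ ⟨h1, -⟩
  exact h1.lt_succ h

lemma ncard_edgesOver {S : Finset ℕ} {P : Finset (Finset ℕ)} (h : IsPartition P S)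
    {B : Finset ℕ} (hB : B ∈ P) {b : ℕ} (hb : b ∈ B) (hmax : ∀ x ∈ B, x ≤ b) :
    (edgesOver P b).ncard = (P.filter (Straddles B)).card := by
  have hd := (isPartition_iff.1 h).2.1
  rw [← Set.ncard_coe_finset]
  symm
  have hstr : ∀ C ∈ P.filter (Straddles B), C ∈ P ∧ b ∉ C ∧ (∃ c ∈ C, c < b) ∧
      ∃ c ∈ C, b < c := by
    intro C hC
    obtain ⟨hC, ⟨c, hc, hcB⟩, c', hc', x, hx, hlt⟩ := Finset.mem_filter.1 hC
    refine ⟨hC, fun hbC => ?_, ⟨c', hc', hlt.trans_le (hmax x hx)⟩, c, hc, hcB b hb⟩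
    obtain rfl := hd B hB C hC b hb hbC
    exact (hcB c hc).ne rfl
  have hex : ∀ C ∈ P.filter (Straddles B), ∃ e : ℕ × ℕ, e.1 ∈ C ∧ e.2 ∈ C ∧ e ∈ edgesOver P b := by
    intro C hC
    obtain ⟨hCP, hbC, ⟨c, hc, hcb⟩, c', hc', hbc⟩ := hstr C hC
    have h1 : (C.filter (· < b)).Nonempty := ⟨c, Finset.mem_filter.2 ⟨hc, hcb⟩⟩
    have h2 : (C.filter (b < ·)).Nonempty := ⟨c', Finset.mem_filter.2 ⟨hc', hbc⟩⟩
    obtain ⟨m1, m1'⟩ := Finset.mem_filter.1 (Finset.max'_mem _ h1)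
    obtain ⟨m2, m2'⟩ := Finset.mem_filter.1 (Finset.min'_mem _ h2)
    refine ⟨((C.filter (· < b)).max' h1, (C.filter (b < ·)).min' h2), m1, m2,
      ⟨m1'.trans m2', C, hCP, m1, m2, fun p hp => ?_⟩, m1', m2'⟩
    rintro ⟨hp1, hp2⟩
    rcases lt_trichotomy p b with hpb | rfl | hpb
    · exact hp1.not_ge (Finset.le_max' _ p (Finset.mem_filter.2 ⟨hp, hpb⟩))
    · exact hbC hp
    · exact hp2.not_ge (Finset.min'_le _ p (Finset.mem_filter.2 ⟨hp, hpb⟩))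
  choose! g hg1 hg2 hg3 using hex
  refine Set.ncard_congr (fun C _ => g C) (fun C hC => hg3 C hC) ?_ ?_
  · intro C D hC hD hCD
    refine hd C (Finset.mem_of_mem_filter C hC) D (Finset.mem_of_mem_filter D hD) (g C).1
      (hg1 C hC) ?_
    rw [hCD]
    exact hg1 D hD
  · rintro ⟨i, j⟩ ⟨⟨hij, C, hC, hi, hj, hC'⟩, hib, hbj⟩
    have hmem : C ∈ P.filter (Straddles B) := Finset.mem_filter.2 ⟨hC,
      ⟨j, hj, fun x hx => (hmax x hx).trans_lt hbj⟩, i, hi, b, hb, hib⟩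
    refine ⟨C, hmem, ?_⟩
    obtain ⟨⟨hlt, D, hD, hDi, hDj, hD'⟩, hb1, hb2⟩ := hg3 C hmem
    obtain rfl := hd C hC D hD _ (hg1 C hmem) hDi
    have e1 := hC' _ hDi
    have e2 := hC' _ hDj
    have e3 := hD' i hi
    have e4 := hD' j hj
    ext <;> simp only at * <;> omega

lemma crol_addTo {n : ℕ} {P : Finset (Finset ℕ)} (h : IsPartition P (seg n))
    {B : Finset ℕ} (hB : B ∈ insert ∅ P) :
    crol (addTo (n + 1) P B) = crol P + (P.filter (Straddles B)).card := by
  rcases Finset.eq_empty_or_nonempty B with rfl | hBn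
  · have h1 : P.filter (Straddles ∅) = ∅ := by
      refine Finset.filter_eq_empty_iff.2 fun C _ hs => ?_
      obtain ⟨-, c, -, b, hb, -⟩ := hs
      simp at hb
    rw [h1, Finset.card_empty, add_zero]
    simp only [crol, isEdge_addTo h hB, Finset.notMem_empty, false_and, and_false, or_false]
  have hBP := (Finset.mem_insert.1 hB).resolve_left hBn.ne_empty
  have hb := B.max'_mem hBn
  have hmax := B.le_max'
  set b := B.max' hBn
  rw [← ncard_edgesOver h hBP hb hmax, crol_eq_ncard, crol_eq_ncard]
  have hinj : Function.Injective fun e : ℕ × ℕ => (e, b, n + 1) := by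
    intro e e' he
    exact (Prod.mk.inj he).1
  rw [← Set.ncard_image_of_injective (edgesOver P b) hinj,
    ← Set.ncard_union_eq ?_ (crossings_finite h) ((edgesOver_finite h b).image _)]
  · congr 1
    ext ⟨⟨i, j⟩, i', j'⟩
    simp only [crossings, edgesOver, Set.mem_ofPred_eq, isEdge_addTo h hB, Set.mem_union,
      Set.mem_image, Prod.mk.injEq, Prod.exists]
    constructor
    · rintro ⟨h1 | ⟨rfl, -, -⟩, h2 | ⟨rfl, hi', hm'⟩, h3, h4, h5⟩
      · exact Or.inl ⟨h1, h2, h3, h4, h5⟩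
      · have hbi : b = i' := le_antisymm (hm' b hb) (hmax i' hi')
        subst hbi
        exact Or.inr ⟨i, j, ⟨h1, h3, h4⟩, ⟨rfl, rfl⟩, rfl, rfl⟩
      · have := (h2.lt_succ h).2
        omega
      · omega
    · rintro (⟨h1, h2, h3⟩ | ⟨i, j, ⟨h1, h2, h3⟩, ⟨rfl, rfl⟩, rfl, rfl⟩)
      · exact ⟨Or.inl h1, Or.inl h2, h3⟩
      · exact ⟨Or.inl h1, Or.inr ⟨rfl, hb, hmax⟩, h2, h3, (h1.lt_succ h).2⟩
  · rw [Set.disjoint_left]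
    rintro _ ⟨-, h2, -⟩ ⟨e, -, rfl⟩
    exact ((h2.lt_succ h).2).ne rfl

lemma mem_partitionsK {n k : ℕ} {P : Finset (Finset ℕ)} :
    P ∈ partitionsK n k ↔ IsPartition P (seg n) ∧ P.card = k := by
  rw [partitionsK, Finset.mem_filter, mem_partitions]

lemma partitionsK_zero_succ (k : ℕ) : partitionsK 0 (k + 1) = ∅ := by
  refine Finset.eq_empty_of_forall_notMem fun P hP => ?_
  obtain ⟨hP, hk⟩ := mem_partitionsK.1 hP
  obtain ⟨B, hB⟩ := Finset.card_pos.1 (hk.symm ▸ Nat.succ_pos k : 0 < P.card)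
  obtain ⟨x, hx⟩ := nonempty_of_mem hP hB
  have := ((isPartition_iff.1 hP).2.2 x).2 ⟨B, hB, hx⟩
  simp [seg] at this

lemma partitionsK_succ_zero (n : ℕ) : partitionsK (n + 1) 0 = ∅ := by
  refine Finset.eq_empty_of_forall_notMem fun P hP => ?_
  obtain ⟨hP, hk⟩ := mem_partitionsK.1 hP
  obtain ⟨B, hB, -⟩ := ((isPartition_iff.1 hP).2.2 (n + 1)).1 (by simp [seg])
  exact Finset.notMem_empty B (Finset.card_eq_zero.1 hk ▸ hB)

lemma stirling_zero_succ (k : ℕ) : stirling 0 (k + 1) = 0 := by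
  rw [stirling, partitionsK_zero_succ, Finset.card_empty]

lemma stirling_succ_zero (n : ℕ) : stirling (n + 1) 0 = 0 := by
  rw [stirling, partitionsK_succ_zero, Finset.card_empty]

lemma cast_stirling (n k : ℕ) : (stirling n k : ℚ) = ∑ _P ∈ partitionsK n k, 1 := by
  simp [stirling]

lemma stirling_succ_succ (n k : ℕ) :
    (stirling (n + 1) (k + 1) : ℚ) = stirling n k + (k + 1) * stirling n (k + 1) := by
  rw [cast_stirling, sum_partitionsK_succ, ← cast_stirling, cast_stirling n (k + 1),
    Finset.mul_sum]
  congr 1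
  refine Finset.sum_congr rfl fun P hP => ?_
  rw [Finset.sum_const, (mem_partitionsK.1 hP).2, nsmul_eq_mul]
  push_cast
  rfl

lemma stirling_pos {n k : ℕ} (hk : 1 ≤ k) (hkn : k ≤ n) : (0 : ℚ) < stirling n k := by
  induction n generalizing k with
  | zero => omega
  | succ n ih =>
    obtain ⟨k, rfl⟩ := Nat.exists_eq_add_of_le' hk
    rw [stirling_succ_succ]
    rcases Nat.lt_or_ge k n with h | h
    · have := ih (k := k + 1) (by omega) (by omega)
      positivity
    · obtain rfl : k = n := by omega
      rcases Nat.eq_zero_or_pos k with rfl | h0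
      · have h00 : stirling 0 0 = 1 := by
          rw [stirling, Finset.card_eq_one]
          refine ⟨∅, Finset.eq_singleton_iff_unique_mem.2 ⟨?_, fun P hP => ?_⟩⟩
          · simp [mem_partitionsK, isPartition_iff, seg]
          · exact Finset.card_eq_zero.1 (mem_partitionsK.1 hP).2
        rw [h00]
        positivity
      · have := ih (k := k) h0 le_rfl
        positivity

lemma sum_precCount_zero (n : ℕ) : ∑ P ∈ partitionsK n 0, precCount P = 0 := by
  refine Finset.sum_eq_zero fun P hP => ?_
  rw [Finset.card_eq_zero.1 (mem_partitionsK.1 hP).2, precCount, Finset.sum_empty]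

lemma sum_crol_zero (n : ℕ) : ∑ P ∈ partitionsK n 0, (crol P : ℚ) = 0 := by
  refine Finset.sum_eq_zero fun P hP => ?_
  rw [Finset.card_eq_zero.1 (mem_partitionsK.1 hP).2]
  simp [crol, IsEdge]

lemma sum_precCount_succ (n k : ℕ) :
    ∑ P ∈ partitionsK (n + 1) (k + 1), precCount P =
      k * ∑ P ∈ partitionsK n (k + 1), precCount P + ∑ P ∈ partitionsK n k, precCount P +
        k * stirling n k := by
  have h1 : ∑ P ∈ partitionsK n k, precCount (addTo (n + 1) P ∅) =
      ∑ P ∈ partitionsK n k, precCount P + k * stirling n k := by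
    rw [cast_stirling, Finset.mul_sum, ← Finset.sum_add_distrib]
    refine Finset.sum_congr rfl fun P hP => ?_
    obtain ⟨hP, hk⟩ := mem_partitionsK.1 hP
    rw [precCount_addTo_empty hP, hk, mul_one]
  have h2 : ∑ P ∈ partitionsK n (k + 1), ∑ B ∈ P, precCount (addTo (n + 1) P B) =
      k * ∑ P ∈ partitionsK n (k + 1), precCount P := by
    rw [Finset.mul_sum]
    refine Finset.sum_congr rfl fun P hP => ?_
    obtain ⟨hP, hk⟩ := mem_partitionsK.1 hP
    rw [Finset.sum_congr rfl fun B hB => precCount_addTo hP hB, Finset.sum_sub_distrib,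
      Finset.sum_const, hk, ← precCount, nsmul_eq_mul]
    push_cast
    ring
  rw [sum_partitionsK_succ, h1, h2]
  ring

lemma sum_crol_succ (n k : ℕ) :
    ∑ P ∈ partitionsK (n + 1) (k + 1), (crol P : ℚ) =
      (k + 1) * ∑ P ∈ partitionsK n (k + 1), (crol P : ℚ) + ∑ P ∈ partitionsK n k, (crol P : ℚ) +
        (k + 1) * k / 2 * stirling n (k + 1) - ∑ P ∈ partitionsK n (k + 1), precCount P := by
  have h1 : ∑ P ∈ partitionsK n k, (crol (addTo (n + 1) P ∅) : ℚ) =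
      ∑ P ∈ partitionsK n k, (crol P : ℚ) := by
    refine Finset.sum_congr rfl fun P hP => ?_
    obtain ⟨hP, hk⟩ := mem_partitionsK.1 hP
    have h0 : P.filter (Straddles ∅) = ∅ := by
      refine Finset.filter_eq_empty_iff.2 fun C _ hs => ?_
      obtain ⟨-, c, -, b, hb, -⟩ := hs
      simp at hb
    rw [crol_addTo hP (Finset.mem_insert_self _ _), h0, Finset.card_empty, add_zero]
  have h2 : ∑ P ∈ partitionsK n (k + 1), ∑ B ∈ P, (crol (addTo (n + 1) P B) : ℚ) =
      (k + 1) * ∑ P ∈ partitionsK n (k + 1), (crol P : ℚ) +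
        (k + 1) * k / 2 * stirling n (k + 1) - ∑ P ∈ partitionsK n (k + 1), precCount P := by
    rw [cast_stirling, Finset.mul_sum, Finset.mul_sum, ← Finset.sum_add_distrib,
      ← Finset.sum_sub_distrib]
    refine Finset.sum_congr rfl fun P hP => ?_
    obtain ⟨hP, hk⟩ := mem_partitionsK.1 hP
    have hs := sum_straddles hP
    rw [hk] at hs
    have hB : ∀ B ∈ P, (crol (addTo (n + 1) P B) : ℚ) =
        crol P + ∑ C ∈ P, if Straddles B C then (1 : ℚ) else 0 := by
      intro B hB
      rw [crol_addTo hP (Finset.mem_insert_of_mem hB), Finset.sum_boole]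
      push_cast
      rfl
    rw [Finset.sum_congr rfl hB, Finset.sum_add_distrib, hs, Finset.sum_const, hk, nsmul_eq_mul]
    push_cast
    ring
  rw [sum_partitionsK_succ, h1, h2]
  ring

lemma sum_precCount (n k : ℕ) :
    ∑ P ∈ partitionsK n (k + 1), precCount P = ((n : ℚ) - k) * stirling n k := by
  induction n generalizing k with
  | zero =>
    rw [partitionsK_zero_succ, Finset.sum_empty]
    cases k <;> simp [stirling_zero_succ]
  | succ n ih =>
    rw [sum_precCount_succ, ih]
    cases k with
    | zero => simp [sum_precCount_zero, stirling_succ_zero]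
    | succ k =>
      rw [ih, stirling_succ_succ]
      push_cast
      ring

lemma sum_crol (n k : ℕ) :
    ∑ P ∈ partitionsK n (k + 1), (crol P : ℚ) =
      ((n : ℚ) * k / 2 - 5 / 4 * (k + 1) * k) * stirling n (k + 1) +
        3 / 2 * ((n : ℚ) - k) * stirling n k := by
  induction n generalizing k with
  | zero =>
    rw [partitionsK_zero_succ, Finset.sum_empty]
    cases k <;> simp [stirling_zero_succ]
  | succ n ih =>
    rw [sum_crol_succ, ih, sum_precCount, stirling_succ_succ]
    cases k with
    | zero =>
      have h0 : (n : ℚ) * stirling n 0 = 0 := by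
        cases n <;> simp [stirling_succ_zero]
      rw [sum_crol_zero, stirling_succ_zero]
      push_cast
      linear_combination 1 / 2 * h0
    | succ k =>
      rw [ih, stirling_succ_succ]
      push_cast
      ring

/-- exact total and average number of linear crossings over `Π_n^k`. -/
theorem crol_mean_over_partitionsK (n k : ℕ) (hk : 1 ≤ k) (hkn : k ≤ n) :
    (∑ π ∈ partitionsK n k, (crol π : ℚ))
        = ((n : ℚ) * ((k : ℚ) - 1) / 2 - (5/4) * (k : ℚ) * ((k : ℚ) - 1)) * (stirling n k : ℚ)
            + (3/2) * ((n : ℚ) + 1 - (k : ℚ)) * (stirling n (k-1) : ℚ) ∧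
    (∑ π ∈ partitionsK n k, (crol π : ℚ)) / (stirling n k : ℚ)
        = (n : ℚ) * ((k : ℚ) - 1) / 2 - (5/2) * (k.choose 2 : ℚ)
            + (3/2) * ((n : ℚ) + 1 - (k : ℚ)) * (stirling n (k-1) : ℚ) / (stirling n k : ℚ) := by
  have hS := stirling_pos hk hkn
  have h1 : ∑ π ∈ partitionsK n k, (crol π : ℚ)
        = ((n : ℚ) * ((k : ℚ) - 1) / 2 - (5/4) * (k : ℚ) * ((k : ℚ) - 1)) * (stirling n k : ℚ)
            + (3/2) * ((n : ℚ) + 1 - (k : ℚ)) * (stirling n (k-1) : ℚ) := by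
    obtain ⟨k, rfl⟩ := Nat.exists_eq_add_of_le' hk
    rw [sum_crol, Nat.add_sub_cancel]
    push_cast
    ring
  refine ⟨h1, ?_⟩
  rw [h1, Nat.cast_choose_two]
  field_simp
  ring
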